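/- Let R = k[x_1, x_2, y_1, y_2]/({x_i y_j : 1 ≤ i, j ≤ 2}) over a field k algebraic over ℚ. Then the torsion submodule of Ω^1_{R/ℚ} is a free k-module of rank 4, with basis the classes of x_i·dy_j for 1 ≤ i, j ≤ 2. -/

import Mathlib

open MvPolynomial

set_option maxHeartbeats 1000000
set_option synthInstance.maxHeartbeats 400000

namespace SkewLines

/-- A functional on differentials coming from two derivations into the residue field. -/
lemma exists_functional {k A : Type} [Field k] [CharZero k] [CommRing A] [Algebra ℚ A]
    (ε : A →+* k) (p q : A →+ k)
    (hp : ∀ a b, p (a * b) = ε a * p b + ε b * p a)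
    (hq : ∀ a b, q (a * b) = ε a * q b + ε b * q a) :
    ∃ L : Ω[A⁄ℚ] →+ k, ∀ a b, L (a • KaehlerDifferential.D ℚ A b) = p a * q b - q a * p b := by
  have hp1 : p 1 = 0 := by simpa using hp 1 1
  have hq1 : q 1 = 0 := by simpa using hq 1 1
  let _ : Module A (k × k × k) :=
    { smul := fun a v => (ε a * v.1, ε a * v.2.1, ε a * v.2.2 + p a * v.2.1 - q a * v.1)
      one_smul := by
        rintro ⟨a, b, c⟩
        change (_, _, _) = _
        simp [hp1, hq1]
      mul_smul := by
        rintro s t ⟨a, b, c⟩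
        change (_, _, _) = (_, _, _)
        simp only [map_mul, hp, hq, Prod.mk.injEq]
        refine ⟨?_, ?_, ?_⟩
        · change _ = ε s * (ε t * a); ring
        · change _ = ε s * (ε t * b); ring
        · change _ = ε s * (ε t * c + p t * b - q t * a) + p s * (ε t * b) - q s * (ε t * a); ring
      smul_zero := by
        intro s
        change (_, _, _) = _
        simp
      smul_add := by
        rintro s ⟨a, b, c⟩ ⟨a', b', c'⟩
        change (_, _, _) = (_, _, _)
        simp only [Prod.mk_add_mk, Prod.mk.injEq]
        refine ⟨?_, ?_, ?_⟩
        · change _ = ε s * a + ε s * a'; ring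
        · change _ = ε s * b + ε s * b'; ring
        · change _ = (ε s * c + p s * b - q s * a) + (ε s * c' + p s * b' - q s * a'); ring
      add_smul := by
        rintro s t ⟨a, b, c⟩
        change (_, _, _) = (_, _, _)
        simp only [map_add, Prod.mk.injEq]
        refine ⟨?_, ?_, ?_⟩
        · change _ = ε s * a + ε t * a; ring
        · change _ = ε s * b + ε t * b; ring
        · change _ = (ε s * c + p s * b - q s * a) + (ε t * c + p t * b - q t * a); ring
      zero_smul := by
        rintro ⟨a, b, c⟩
        change (_, _, _) = _
        simp }
  have smul_def : ∀ (s : A) (v : k × k × k),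
      s • v = (ε s * v.1, ε s * v.2.1, ε s * v.2.2 + p s * v.2.1 - q s * v.1) := fun _ _ => rfl
  have : IsScalarTower ℚ A (k × k × k) := ⟨by
    rintro r s ⟨a, b, c⟩
    have h1 : ε (r • s) = r • ε s := map_rat_smul ε r s
    have h2 : p (r • s) = r • p s := map_rat_smul p r s
    have h3 : q (r • s) = r • q s := map_rat_smul q r s
    rw [smul_def, smul_def, h1, h2, h3]
    refine Prod.ext ?_ (Prod.ext ?_ ?_)
    · change _ = r • (ε s * a)
      simp only [Algebra.smul_def]; ring
    · change _ = r • (ε s * b)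
      simp only [Algebra.smul_def]; ring
    · change _ = r • (ε s * c + p s * b - q s * a)
      simp only [Algebra.smul_def]; ring⟩
  let d₀ : A →+ k × k × k :=
    { toFun := fun a => (p a, q a, 0)
      map_zero' := by simp
      map_add' := by intro a b; simp }
  let d : Derivation ℚ A (k × k × k) := Derivation.mk' d₀.toRatLinearMap (by
    intro a b
    change (p (a * b), q (a * b), (0 : k)) = a • (p b, q b, (0 : k)) + b • (p a, q a, (0 : k))
    rw [smul_def, smul_def, hp, hq]
    simp only [Prod.mk_add_mk, Prod.mk.injEq]
    refine ⟨trivial, trivial, by ring⟩)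
  let l := d.liftKaehlerDifferential
  refine ⟨((AddMonoidHom.snd k k).comp (AddMonoidHom.snd k (k × k))).comp l.toAddMonoidHom, ?_⟩
  intro a b
  change (l (a • KaehlerDifferential.D ℚ A b)).2.2 = _
  rw [map_smul, Derivation.liftKaehlerDifferential_comp_D, smul_def]
  change ε a * 0 + p a * q b - q a * p b = _
  ring

variable (k : Type) [Field k]

noncomputable abbrev J : Ideal (MvPolynomial (Fin 4) k) :=
  Ideal.span {X 0 * X 2, X 0 * X 3, X 1 * X 2, X 1 * X 3}

noncomputable abbrev S := MvPolynomial (Fin 4) k ⧸ J k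

noncomputable abbrev z (i : Fin 4) : S k := Ideal.Quotient.mk (J k) (X i)

lemma rel02 : z k 0 * z k 2 = 0 := by
  rw [← map_mul]; exact Ideal.Quotient.eq_zero_iff_mem.2 (Ideal.subset_span (by simp))
lemma rel03 : z k 0 * z k 3 = 0 := by
  rw [← map_mul]; exact Ideal.Quotient.eq_zero_iff_mem.2 (Ideal.subset_span (by simp))
lemma rel12 : z k 1 * z k 2 = 0 := by
  rw [← map_mul]; exact Ideal.Quotient.eq_zero_iff_mem.2 (Ideal.subset_span (by simp))
lemma rel13 : z k 1 * z k 3 = 0 := by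
  rw [← map_mul]; exact Ideal.Quotient.eq_zero_iff_mem.2 (Ideal.subset_span (by simp))

/-- Algebra homs out of the coordinate ring. -/
lemma exists_hom {B : Type} [CommRing B] [Algebra k B] (u : Fin 4 → B)
    (h02 : u 0 * u 2 = 0) (h03 : u 0 * u 3 = 0) (h12 : u 1 * u 2 = 0) (h13 : u 1 * u 3 = 0) :
    ∃ f : S k →ₐ[k] B, ∀ i, f (z k i) = u i := by
  refine ⟨Ideal.Quotient.liftₐ (J k) (aeval u) ?_, fun i => ?_⟩
  · intro a ha
    have : J k ≤ RingHom.ker (aeval u : MvPolynomial (Fin 4) k →ₐ[k] B) := by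
      rw [Ideal.span_le]
      intro a ha
      simp only [Set.mem_insert_iff, Set.mem_singleton_iff] at ha
      rcases ha with rfl | rfl | rfl | rfl <;>
        simp only [SetLike.mem_coe, RingHom.mem_ker, map_mul, aeval_X] <;> assumption
    exact this ha
  · exact aeval_X u i

/-- Derivations of the coordinate ring. -/
lemma exists_der (u : Fin 4 → S k)
    (h02 : z k 0 * u 2 + z k 2 * u 0 = 0) (h03 : z k 0 * u 3 + z k 3 * u 0 = 0)
    (h12 : z k 1 * u 2 + z k 2 * u 1 = 0) (h13 : z k 1 * u 3 + z k 3 * u 1 = 0) :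
    ∃ E : Derivation k (S k) (S k), ∀ i, E (z k i) = u i := by
  let d := mkDerivation k (A := S k) u
  have sm : ∀ (a : MvPolynomial (Fin 4) k) (b : S k), a • b = Ideal.Quotient.mk (J k) a * b :=
    fun a b => Algebra.smul_def a b
  have hd : ∀ a ∈ J k, d a = 0 := by
    intro a ha
    refine Submodule.span_induction (p := fun a _ => d a = 0) ?_ ?_ ?_ ?_ ha
    · intro a ha
      simp only [Set.mem_insert_iff, Set.mem_singleton_iff] at ha
      rcases ha with rfl | rfl | rfl | rfl <;>
        simp only [d, Derivation.leibniz, mkDerivation_X, sm] <;> assumption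
    · simp
    · intro a b _ _ h1 h2; simp [h1, h2]
    · intro a b hb h1
      have : Ideal.Quotient.mk (J k) b = 0 := Ideal.Quotient.eq_zero_iff_mem.2 hb
      rw [smul_eq_mul, Derivation.leibniz, h1, sm, sm, this]; simp
  let l : S k →ₗ[k] S k :=
    { toFun := Quotient.lift (s := Submodule.quotientRel (J k)) (fun a => d a) (by
        intro a b hab
        have : a - b ∈ J k := (Submodule.quotientRel_def _).1 hab
        have := hd _ this
        rwa [map_sub, sub_eq_zero] at this)
      map_add' := by
        intro a b
        obtain ⟨a, rfl⟩ := Ideal.Quotient.mk_surjective a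
        obtain ⟨b, rfl⟩ := Ideal.Quotient.mk_surjective b
        exact map_add d a b
      map_smul' := by
        intro c b
        obtain ⟨b, rfl⟩ := Ideal.Quotient.mk_surjective b
        exact Derivation.map_smul d c b }
  have hl : ∀ a, l (Ideal.Quotient.mk (J k) a) = d a := fun _ => rfl
  refine ⟨Derivation.mk' l ?_, ?_⟩
  · intro a b
    obtain ⟨a, rfl⟩ := Ideal.Quotient.mk_surjective a
    obtain ⟨b, rfl⟩ := Ideal.Quotient.mk_surjective b
    rw [← map_mul, hl, hl, hl, Derivation.leibniz, sm, sm]; rfl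
  · intro i
    exact (hl _).trans (mkDerivation_X _ _ _)

lemma S_induction (P : S k → Prop) (hC : ∀ c, P (algebraMap k (S k) c))
    (ha : ∀ a b, P a → P b → P (a + b)) (hm : ∀ a i, P a → P (a * z k i)) (a : S k) : P a := by
  obtain ⟨a, rfl⟩ := Ideal.Quotient.mk_surjective a
  induction a using MvPolynomial.induction_on with
  | C c => exact hC c
  | add p q hp hq => rw [map_add]; exact ha _ _ hp hq
  | mul_X p i hp => rw [map_mul]; exact hm _ _ hp

/-- Annihilator of `x₁` lies in `(y)`. -/
lemma ann_x (a : S k) (h : z k 0 * a = 0) : ∃ s t, a = s * z k 2 + t * z k 3 := by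
  obtain ⟨f, hf⟩ := exists_hom k (![X 0, X 1, 0, 0] : Fin 4 → MvPolynomial (Fin 4) k)
    (by simp) (by simp) (by simp) (by simp)
  have key : ∀ a : S k, ∃ s t, a = Ideal.Quotient.mk (J k) (f a) + (s * z k 2 + t * z k 3) := by
    intro a
    induction a using S_induction with
    | hC c => exact ⟨0, 0, by rw [AlgHom.commutes]; simp; rfl⟩
    | ha a b h1 h2 =>
      obtain ⟨s, t, h1⟩ := h1
      obtain ⟨s', t', h2⟩ := h2
      refine ⟨s + s', t + t', ?_⟩
      rw [map_add, map_add]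
      linear_combination h1 + h2
    | hm a i h1 =>
      obtain ⟨s, t, h1⟩ := h1
      rw [map_mul, map_mul, hf]
      fin_cases i
      · exact ⟨s * z k 0, t * z k 0, by simp; linear_combination z k 0 * h1⟩
      · exact ⟨s * z k 1, t * z k 1, by simp; linear_combination z k 1 * h1⟩
      · exact ⟨a, 0, by simp⟩
      · exact ⟨0, a, by simp⟩
  have h0 : f a = 0 := by
    have := congrArg f h
    rw [map_mul, hf, map_zero] at this
    simpa using this
  obtain ⟨s, t, h1⟩ := key a
  exact ⟨s, t, by rw [h1]; rw [h0]; simp⟩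

/-- The projection to the `y`-plane. -/
lemma proj_y : ∃ f : S k →ₐ[k] MvPolynomial (Fin 4) k, f (z k 2) = X 2 ∧ f (z k 3) = X 3 ∧
    ∀ a : S k, ∃ s t, a = Ideal.Quotient.mk (J k) (f a) + (s * z k 0 + t * z k 1) := by
  obtain ⟨f, hf⟩ := exists_hom k (![0, 0, X 2, X 3] : Fin 4 → MvPolynomial (Fin 4) k)
    (by simp) (by simp) (by simp) (by simp)
  refine ⟨f, hf 2, hf 3, ?_⟩
  intro a
  induction a using S_induction with
  | hC c => exact ⟨0, 0, by rw [AlgHom.commutes]; simp; rfl⟩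
  | ha a b h1 h2 =>
    obtain ⟨s, t, h1⟩ := h1
    obtain ⟨s', t', h2⟩ := h2
    refine ⟨s + s', t + t', ?_⟩
    rw [map_add, map_add]
    linear_combination h1 + h2
  | hm a i h1 =>
    obtain ⟨s, t, h1⟩ := h1
    rw [map_mul, map_mul, hf]
    fin_cases i
    · exact ⟨a, 0, by simp⟩
    · exact ⟨0, a, by simp⟩
    · exact ⟨s * z k 2, t * z k 2, by simp; linear_combination z k 2 * h1⟩
    · exact ⟨s * z k 3, t * z k 3, by simp; linear_combination z k 3 * h1⟩

/-- Annihilator of `y₁` lies in `(x)`. -/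
lemma ann_y (a : S k) (h : z k 2 * a = 0) : ∃ s t, a = s * z k 0 + t * z k 1 := by
  obtain ⟨f, hf, -, key⟩ := proj_y k
  have h0 : f a = 0 := by
    have := congrArg f h
    rw [map_mul, hf, map_zero] at this
    simpa using this
  obtain ⟨s, t, h1⟩ := key a
  exact ⟨s, t, by rw [h1]; rw [h0]; simp⟩

/-- `(x) ∩ (y) = 0`, in the form needed. -/
lemma eq_zero_of (a : S k) (h0 : z k 0 * a = 0) (h2 : z k 2 * a = 0) : a = 0 := by
  obtain ⟨f, hf2, hf3, key⟩ := proj_y k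
  have hfa : f a = 0 := by
    have := congrArg f h2
    rw [map_mul, hf2, map_zero] at this
    simpa using this
  obtain ⟨s, t, h⟩ := ann_x k a h0
  obtain ⟨s1, s2, hs⟩ := key s
  obtain ⟨t1, t2, ht⟩ := key t
  have e1 := congrArg (Ideal.Quotient.mk (J k)) (congrArg f h)
  rw [hfa, map_add, map_mul, map_mul, hf2, hf3, map_add, map_mul, map_mul, map_zero] at e1
  linear_combination h + z k 2 * hs + z k 3 * ht - e1 + s1 * rel02 k + s2 * rel12 k
    + t1 * rel03 k + t2 * rel13 k

lemma mem_nzd : z k 0 + z k 2 ∈ nonZeroDivisors (S k) := by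
  rw [mem_nonZeroDivisors_iff_right]
  intro a h
  have h00 : z k 0 * (z k 0 * a) = 0 := by
    linear_combination z k 0 * h - a * rel02 k
  have h22 : z k 2 * (z k 2 * a) = 0 := by
    linear_combination z k 2 * h - a * rel02 k
  refine eq_zero_of k a (eq_zero_of k _ h00 ?_) (eq_zero_of k _ ?_ h22)
  · linear_combination a * rel02 k
  · linear_combination a * rel02 k

noncomputable abbrev xs : Fin 2 → S k :=
  ![Ideal.Quotient.mk (J k) (X 0), Ideal.Quotient.mk (J k) (X 1)]

noncomputable abbrev ys : Fin 2 → S k :=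
  ![Ideal.Quotient.mk (J k) (X 2), Ideal.Quotient.mk (J k) (X 3)]

lemma rel (i j : Fin 2) : xs k i * ys k j = 0 := by
  fin_cases i <;> fin_cases j
  · exact rel02 k
  · exact rel03 k
  · exact rel12 k
  · exact rel13 k

lemma S_induction2 (P : S k → Prop) (hC : ∀ c, P (algebraMap k (S k) c))
    (ha : ∀ a b, P a → P b → P (a + b)) (hx : ∀ a i, P a → P (a * xs k i))
    (hy : ∀ a i, P a → P (a * ys k i)) (a : S k) : P a := by
  refine S_induction k P hC ha ?_ a
  intro a l h
  fin_cases l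
  · exact hx a 0 h
  · exact hx a 1 h
  · exact hy a 0 h
  · exact hy a 1 h

lemma exists_pq (i j : Fin 2) : ∃ (ε : S k →+* k) (p q : S k →+ k),
    (∀ a b, p (a * b) = ε a * p b + ε b * p a) ∧ (∀ a b, q (a * b) = ε a * q b + ε b * q a) ∧
    (∀ c l, p (algebraMap k (S k) c * xs k l) = if i = l then c else 0) ∧
    (∀ l, p (ys k l) = 0) ∧ (∀ c l, q (algebraMap k (S k) c * xs k l) = 0) ∧
    (∀ l, q (ys k l) = if j = l then 1 else 0) := by
  obtain ⟨f, hf⟩ := exists_hom k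
    (fun i => (TrivSqZeroExt.inr (Pi.single i 1) : TrivSqZeroExt k (Fin 4 → k)))
    (by simp) (by simp) (by simp) (by simp)
  let pr : Fin 4 → S k →+ k := fun l =>
    { toFun := fun a => (f a).snd l
      map_zero' := by simp
      map_add' := by intro a b; simp }
  have hpr : ∀ l a b, pr l (a * b) = (f a).fst * pr l b + (f b).fst * pr l a := by
    intro l a b
    change (f (a * b)).snd l = (f a).fst * (f b).snd l + (f b).fst * (f a).snd l
    simp
  let ε : S k →+* k := (TrivSqZeroExt.fstHom k k (Fin 4 → k)).toRingHom.comp f.toRingHom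
  have hz : ∀ l m, pr l (z k m) = if l = m then 1 else 0 := by
    intro l m
    change (f (z k m)).snd l = _
    rw [hf]
    simp [Pi.single_apply]
  have hcz : ∀ l m c, pr l (algebraMap k (S k) c * z k m) = if l = m then c else 0 := by
    intro l m c
    change (f (algebraMap k (S k) c * z k m)).snd l = _
    rw [map_mul, hf, AlgHom.commutes]
    simp [Pi.single_apply, TrivSqZeroExt.algebraMap_eq_inl]
  refine ⟨ε, pr (![0, 1] i), pr (![2, 3] j), fun a b => hpr _ a b, fun a b => hpr _ a b,
    ?_, ?_, ?_, ?_⟩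
  · intro c l
    fin_cases l
    · exact (hcz _ 0 c).trans (by fin_cases i <;> simp)
    · exact (hcz _ 1 c).trans (by fin_cases i <;> simp)
  · intro l
    fin_cases l
    · exact (hz _ 2).trans (by fin_cases i <;> simp)
    · exact (hz _ 3).trans (by fin_cases i <;> simp)
  · intro c l
    fin_cases l
    · exact (hcz _ 0 c).trans (by fin_cases j <;> simp)
    · exact (hcz _ 1 c).trans (by fin_cases j <;> simp)
  · intro l
    fin_cases l
    · exact (hz _ 2).trans (by fin_cases j <;> simp)
    · exact (hz _ 3).trans (by fin_cases j <;> simp)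

lemma ders [CharZero k] :
    (∀ i, ∃ E : Derivation ℚ (S k) (S k), (∀ l, E (xs k l) = if l = i then xs k 0 else 0) ∧
      ∀ l, E (ys k l) = 0) ∧
    (∀ i, ∃ E : Derivation ℚ (S k) (S k), (∀ l, E (ys k l) = if l = i then ys k 0 else 0) ∧
      ∀ l, E (xs k l) = 0) := by
  have r02 := rel02 k
  have r03 := rel03 k
  have r12 := rel12 k
  have r13 := rel13 k
  have two : ∀ P : Fin 2 → Prop, P 0 → P 1 → ∀ l, P l := fun P h0 h1 l => by
    fin_cases l
    · exact h0
    · exact h1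
  constructor
  · refine two _ ?_ ?_
    · obtain ⟨E, h⟩ := exists_der k ![z k 0, 0, 0, 0] (by simp [mul_comm, r02])
        (by simp [mul_comm, r03]) (by simp) (by simp)
      exact ⟨E.restrictScalars ℚ, two _ (h 0) (h 1), two _ (h 2) (h 3)⟩
    · obtain ⟨E, h⟩ := exists_der k ![0, z k 0, 0, 0] (by simp) (by simp)
        (by simp [mul_comm, r02]) (by simp [mul_comm, r03])
      exact ⟨E.restrictScalars ℚ, two _ (h 0) (h 1), two _ (h 2) (h 3)⟩
  · refine two _ ?_ ?_
    · obtain ⟨E, h⟩ := exists_der k ![0, 0, z k 2, 0] (by simp [r02]) (by simp)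
        (by simp [r12]) (by simp)
      exact ⟨E.restrictScalars ℚ, two _ (h 2) (h 3), two _ (h 0) (h 1)⟩
    · obtain ⟨E, h⟩ := exists_der k ![0, 0, 0, z k 2] (by simp) (by simp [r02]) (by simp)
        (by simp [r12])
      exact ⟨E.restrictScalars ℚ, two _ (h 2) (h 3), two _ (h 0) (h 1)⟩

end SkewLines

namespace SkewLines

/-- The abstract version of the computation, for any ring with the needed properties. -/
lemma generic (k A : Type) [Field k] [CharZero k] [Algebra.IsAlgebraic ℚ k]
    [CommRing A] [Algebra ℚ A] [Algebra k A] [IsScalarTower ℚ k A]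
    (x y : Fin 2 → A) (rel : ∀ i j, x i * y j = 0)
    (ind : ∀ (P : A → Prop) (_hC : ∀ c, P (algebraMap k A c))
      (_ha : ∀ a b, P a → P b → P (a + b)) (_hx : ∀ a i, P a → P (a * x i))
      (_hy : ∀ a i, P a → P (a * y i)) (a : A), P a)
    (nzd : x 0 + y 0 ∈ nonZeroDivisors A)
    (pq : ∀ i j : Fin 2, ∃ (ε : A →+* k) (p q : A →+ k),
      (∀ a b, p (a * b) = ε a * p b + ε b * p a) ∧ (∀ a b, q (a * b) = ε a * q b + ε b * q a) ∧
      (∀ c l, p (algebraMap k A c * x l) = if i = l then c else 0) ∧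
      (∀ l, p (y l) = 0) ∧ (∀ c l, q (algebraMap k A c * x l) = 0) ∧
      (∀ l, q (y l) = if j = l then 1 else 0))
    (derx : ∀ i, ∃ E : Derivation ℚ A A, (∀ l, E (x l) = if l = i then x 0 else 0) ∧
      ∀ l, E (y l) = 0)
    (dery : ∀ i, ∃ E : Derivation ℚ A A, (∀ l, E (y l) = if l = i then y 0 else 0) ∧
      ∀ l, E (x l) = 0)
    (annx : ∀ a, x 0 * a = 0 → ∃ s t, a = s * y 0 + t * y 1)
    (anny : ∀ a, y 0 * a = 0 → ∃ s t, a = s * x 0 + t * x 1) :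
    (∀ i j, x i • KaehlerDifferential.D ℚ A (y j) ∈ Submodule.torsion A (Ω[A⁄ℚ])) ∧
    (∀ c : Fin 2 → Fin 2 → k,
      (∑ i, ∑ j, algebraMap k A (c i j) • x i • KaehlerDifferential.D ℚ A (y j)) = 0 →
        ∀ i j, c i j = 0) ∧
    (∀ m ∈ Submodule.torsion A (Ω[A⁄ℚ]), ∃ c : Fin 2 → Fin 2 → k,
      m = ∑ i, ∑ j, algebraMap k A (c i j) • x i • KaehlerDifferential.D ℚ A (y j)) := by
  set δ := KaehlerDifferential.D ℚ A with hδ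
  have drel : ∀ i j, y j • δ (x i) = - (x i • δ (y j)) := by
    intro i j
    have := δ.leibniz (x i) (y j)
    rw [rel, map_zero] at this
    rw [eq_neg_iff_add_eq_zero, add_comm]
    exact this.symm
  have xk : ∀ l i j, x l • x i • δ (y j) = 0 := by
    intro l i j
    rw [← neg_eq_zero, ← smul_neg, ← drel, smul_smul, rel, zero_smul]
  have yk : ∀ l i j, y l • x i • δ (y j) = 0 := by
    intro l i j
    rw [smul_smul, mul_comm, rel, zero_smul]
  have scal : ∀ a : A, ∃ c : k, ∀ i j, a • x i • δ (y j) = algebraMap k A c • x i • δ (y j) := by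
    intro a
    induction a using ind with
    | _hC c => exact ⟨c, fun _ _ => rfl⟩
    | _ha a b h1 h2 =>
      obtain ⟨c, h1⟩ := h1
      obtain ⟨d, h2⟩ := h2
      exact ⟨c + d, fun i j => by rw [add_smul, h1, h2, map_add, add_smul]⟩
    | _hx a l h1 =>
      exact ⟨0, fun i j => by rw [mul_smul, xk, smul_zero, map_zero, zero_smul]⟩
    | _hy a l h1 =>
      exact ⟨0, fun i j => by rw [mul_smul, yk, smul_zero, map_zero, zero_smul]⟩
  have hconst : ∀ c : k, δ (algebraMap k A c) = 0 := by
    intro c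
    have : Algebra.FormallyUnramified ℚ k := Algebra.FormallyUnramified.of_isSeparable ℚ k
    have hc : KaehlerDifferential.D ℚ k c = 0 := Subsingleton.elim _ _
    have := KaehlerDifferential.map_D ℚ ℚ k A c
    rw [hc, map_zero] at this
    exact this.symm
  have gen : ∀ m : Ω[A⁄ℚ], ∃ a b : Fin 2 → A, m = ∑ i, a i • δ (x i) + ∑ i, b i • δ (y i) := by
    intro m
    have h : m ∈ (⊤ : Submodule A (Ω[A⁄ℚ])) := trivial
    rw [← KaehlerDifferential.span_range_derivation] at h
    have h2 : m ∈ Submodule.span A (Set.range fun i => δ (x i)) ⊔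
        Submodule.span A (Set.range fun i => δ (y i)) := by
      refine Submodule.span_le.2 ?_ h
      rintro _ ⟨a, rfl⟩
      rw [SetLike.mem_coe]
      induction a using ind with
      | _hC c =>
        have := hconst c
        rw [this]; exact zero_mem _
      | _ha a b h1 h2 => rw [map_add]; exact add_mem h1 h2
      | _hx a i h1 =>
        rw [Derivation.leibniz]
        exact add_mem (Submodule.smul_mem _ _
          (Submodule.mem_sup_left (Submodule.subset_span ⟨i, rfl⟩))) (Submodule.smul_mem _ _ h1)
      | _hy a i h1 =>
        rw [Derivation.leibniz]
        exact add_mem (Submodule.smul_mem _ _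
          (Submodule.mem_sup_right (Submodule.subset_span ⟨i, rfl⟩))) (Submodule.smul_mem _ _ h1)
    obtain ⟨u, hu, v, hv, rfl⟩ := Submodule.mem_sup.1 h2
    obtain ⟨a, rfl⟩ := (Submodule.mem_span_range_iff_exists_fun A).1 hu
    obtain ⟨b, rfl⟩ := (Submodule.mem_span_range_iff_exists_fun A).1 hv
    exact ⟨a, b, rfl⟩
  refine ⟨?_, ?_, ?_⟩
  · intro i j
    rw [Submodule.mem_torsion_iff]
    refine ⟨⟨_, nzd⟩, ?_⟩
    change (x 0 + y 0) • x i • δ (y j) = 0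
    rw [add_smul, xk, yk, add_zero]
  · intro c h i j
    obtain ⟨ε, p, q, hp, hq, h1, h2, h3, h4⟩ := pq i j
    obtain ⟨L, hL⟩ := exists_functional ε p q hp hq
    have h' := congrArg L h
    simp only [Fin.sum_univ_two, map_add, smul_smul, map_zero, hδ, hL, h1, h2, h3, h4] at h'
    fin_cases i <;> fin_cases j <;> simpa using h'
  · intro m hm
    obtain ⟨a, b, rfl⟩ := gen m
    obtain ⟨s, hs⟩ := (Submodule.mem_torsion_iff _).1 hm
    have hE : ∀ E : Derivation ℚ A A, ∑ i, a i * E (x i) + ∑ i, b i * E (y i) = 0 := by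
      intro E
      have h := congrArg E.liftKaehlerDifferential hs
      rw [Submonoid.smul_def, map_smul, map_zero, map_add, map_sum, map_sum] at h
      simp only [map_smul, hδ, Derivation.liftKaehlerDifferential_comp_D, smul_eq_mul] at h
      exact (mul_left_mem_nonZeroDivisors_eq_zero_iff s.2).1 h
    have qx : ∀ i, x 0 * a i = 0 := by
      intro i
      obtain ⟨E, h, h'⟩ := derx i
      simpa [h, h', mul_comm] using hE E
    have qy : ∀ i, y 0 * b i = 0 := by
      intro i
      obtain ⟨E, h, h'⟩ := dery i
      simpa [h, h', mul_comm] using hE E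
    obtain ⟨s0, t0, e0⟩ := annx _ (qx 0)
    obtain ⟨s1, t1, e1⟩ := annx _ (qx 1)
    obtain ⟨s2, t2, e2⟩ := anny _ (qy 0)
    obtain ⟨s3, t3, e3⟩ := anny _ (qy 1)
    obtain ⟨c00, h00⟩ := scal (s2 - s0)
    obtain ⟨c01, h01⟩ := scal (s3 - t0)
    obtain ⟨c10, h10⟩ := scal (t2 - s1)
    obtain ⟨c11, h11⟩ := scal (t3 - t1)
    refine ⟨![![c00, c01], ![c10, c11]], ?_⟩
    simp only [Fin.sum_univ_two]
    change _ = algebraMap k A c00 • x 0 • δ (y 0) + algebraMap k A c01 • x 0 • δ (y 1)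
      + (algebraMap k A c10 • x 1 • δ (y 0) + algebraMap k A c11 • x 1 • δ (y 1))
    rw [← h00, ← h01, ← h10, ← h11, e0, e1, e2, e3]
    simp only [add_smul, mul_smul, sub_smul, drel, smul_neg]
    abel

end SkewLines

/-- Let `R = k[x₁,x₂,y₁,y₂]/(xᵢyⱼ)` over a field `k` algebraic over `ℚ`
(so `Ω¹_{R/ℚ} = Ω¹_{R/k}`).  The torsion submodule of `Ω¹_{R/ℚ}` (elements killed by a
non-zerodivisor of `R`) is a free `k`-module of rank `4`, with basis the classes
`xᵢ·dyⱼ` (`1 ≤ i, j ≤ 2`): these four elements are torsion, are `k`-linearly independent,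
and `k`-span the torsion submodule. -/
theorem torsion_kaehler_skew_lines (k : Type) [Field k] [CharZero k]
    [Algebra.IsAlgebraic ℚ k] :
    letI I : Ideal (MvPolynomial (Fin 4) k) :=
      Ideal.span {X 0 * X 2, X 0 * X 3, X 1 * X 2, X 1 * X 3}
    letI R := MvPolynomial (Fin 4) k ⧸ I
    letI D := KaehlerDifferential.D ℚ R
    letI x : Fin 2 → R := ![Ideal.Quotient.mk I (X 0), Ideal.Quotient.mk I (X 1)]
    letI y : Fin 2 → R := ![Ideal.Quotient.mk I (X 2), Ideal.Quotient.mk I (X 3)]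
    letI v : Fin 2 → Fin 2 → Ω[R⁄ℚ] := fun i j => x i • D (y j)
    (∀ i j, v i j ∈ Submodule.torsion R (Ω[R⁄ℚ])) ∧
    (∀ c : Fin 2 → Fin 2 → k,
      (∑ i, ∑ j, algebraMap k R (c i j) • v i j) = 0 → ∀ i j, c i j = 0) ∧
    (∀ m ∈ Submodule.torsion R (Ω[R⁄ℚ]), ∃ c : Fin 2 → Fin 2 → k,
      m = ∑ i, ∑ j, algebraMap k R (c i j) • v i j) := by
  exact SkewLines.generic k (SkewLines.S k) (SkewLines.xs k) (SkewLines.ys k) (SkewLines.rel k)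
    (SkewLines.S_induction2 k) (SkewLines.mem_nzd k) (SkewLines.exists_pq k)
    (SkewLines.ders k).1 (SkewLines.ders k).2 (SkewLines.ann_x k) (SkewLines.ann_y k)
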